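/- (Analytic core of the Non-mixing Theorem 1S.) Let σ > 0. The function t ↦ −h′(t)/h(t)² is strictly increasing on [0,1). Consequently, for every λ > 0 there is at most one t ∈ [0,1) with h′(t) + λ·h(t)² = 0, and in particular the identity λ·h(t)² = −h′(t) (equivalently, 1/h(t) = λ·t + const) cannot hold on any nondegenerate subinterval of [0,1). -/

import Mathlib

/-- The standard normal cumulative distribution function
`Φ(x) = (1/√(2π)) ∫_{-∞}^x e^{-u²/2} du`. -/
noncomputable def Phi (x : ℝ) : ℝ :=
  (Real.sqrt (2 * Real.pi))⁻¹ * ∫ u in Set.Iic x, Real.exp (-u ^ 2 / 2)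

/-- The discount function `h(t) = 2Φ(σ(1-t)/2) - 1` for volatility `σ`. -/
noncomputable def h (σ t : ℝ) : ℝ := 2 * Phi (σ * (1 - t) / 2) - 1

/-- `g(t) = ∫₀ᵗ h(u) du`. -/
noncomputable def g (σ t : ℝ) : ℝ := ∫ u in (0:ℝ)..t, h σ u

/-- The explicit derivative of `h`: `h′(t) = -(σ/√(2π))·exp(-σ²(1-t)²/8)`. -/
noncomputable def hDeriv (σ t : ℝ) : ℝ :=
  -(σ / Real.sqrt (2 * Real.pi)) * Real.exp (-(σ ^ 2 * (1 - t) ^ 2) / 8)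

theorem aux_int : MeasureTheory.Integrable (fun u : ℝ => Real.exp (-u ^ 2 / 2)) := by
  have := integrable_exp_neg_mul_sq (b := 1/2) (by norm_num)
  refine this.congr (Filter.Eventually.of_forall fun u => ?_)
  simp only
  congr 1
  ring

theorem aux_half : Phi 0 = 1 / 2 := by
  have h1 := integral_gaussian_Ioi (1/2)
  have h2 := integral_comp_neg_Iic (0:ℝ) (fun u : ℝ => Real.exp (-(1/2) * u ^ 2))
  rw [neg_zero, h1] at h2
  have h3 : (fun u : ℝ => Real.exp (-u ^ 2 / 2))
      = fun u : ℝ => Real.exp (-(1/2) * (-u) ^ 2) := by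
    funext u
    congr 1
    ring
  unfold Phi
  rw [h3, h2]
  have h4 : Real.pi / (1/2) = 2 * Real.pi := by ring
  rw [h4]
  have : 0 < Real.sqrt (2 * Real.pi) := Real.sqrt_pos.2 (by positivity)
  field_simp

theorem aux_mono : StrictMono Phi := by
  intro a b hab
  unfold Phi
  have : 0 < Real.sqrt (2 * Real.pi) := Real.sqrt_pos.2 (by positivity)
  refine mul_lt_mul_of_pos_left ?_ (inv_pos.2 this)
  have h1 := intervalIntegral.integral_Iic_sub_Iic (a := a) (b := b)
    aux_int.integrableOn aux_int.integrableOn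
  have h2 : 0 < ∫ u in a..b, Real.exp (-u ^ 2 / 2) :=
    intervalIntegral.intervalIntegral_pos_of_pos
      aux_int.intervalIntegrable (fun u => Real.exp_pos _) hab
  linarith

theorem aux_main (σ : ℝ) (hσ : 0 < σ) :
    StrictMonoOn (fun t => -(hDeriv σ t) / (h σ t) ^ 2) (Set.Ico 0 1) := by
  intro s hs t ht hst
  have hpos : 0 < h σ t := by
    have : Phi 0 < Phi (σ * (1 - t) / 2) :=
      aux_mono (by have := mul_pos hσ (sub_pos.2 ht.2); linarith)
    rw [aux_half] at this
    unfold h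
    linarith
  have hlt : h σ t < h σ s := by
    have : Phi (σ * (1 - t) / 2) < Phi (σ * (1 - s) / 2) :=
      aux_mono (by have := mul_pos hσ (sub_pos.2 hst); linarith)
    unfold h
    linarith
  have hc : 0 < σ / Real.sqrt (2 * Real.pi) := by positivity
  have hd : -(hDeriv σ s) ≤ -(hDeriv σ t) := by
    unfold hDeriv
    rw [neg_mul, neg_neg, neg_mul, neg_neg]
    refine mul_le_mul_of_nonneg_left (Real.exp_le_exp.2 ?_) hc.le
    have h1 : (1 - t) ^ 2 ≤ (1 - s) ^ 2 :=
      pow_le_pow_left₀ (by linarith [ht.2]) (by linarith) 2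
    have := mul_le_mul_of_nonneg_left h1 (sq_nonneg σ)
    linarith
  have hp : 0 < -(hDeriv σ t) := by
    unfold hDeriv
    rw [neg_mul, neg_neg]
    positivity
  exact div_lt_div₀' hd (pow_lt_pow_left₀ hlt hpos.le two_ne_zero) hp (by positivity)

theorem aux_pos (σ : ℝ) (hσ : 0 < σ) (t : ℝ) (ht : t ∈ Set.Ico (0:ℝ) 1) : 0 < h σ t := by
  have : Phi 0 < Phi (σ * (1 - t) / 2) :=
    aux_mono (by have := mul_pos hσ (sub_pos.2 ht.2); linarith)
  rw [aux_half] at this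
  unfold h
  linarith

/-- Analytic core of the Non-mixing Theorem 1S: `t ↦ -h′(t)/h(t)²` is strictly increasing on
`[0,1)`; hence for each `λ > 0` the equation `h′(t) + λ h(t)² = 0` has at most one solution in
`[0,1)`, and the identity `λ h(t)² = -h′(t)` cannot hold on a nondegenerate subinterval. -/
theorem stmt_13 (σ : ℝ) (hσ : 0 < σ) :
    StrictMonoOn (fun t => -(hDeriv σ t) / (h σ t) ^ 2) (Set.Ico 0 1) ∧
    (∀ lam : ℝ, 0 < lam →
      (∀ t₁ ∈ Set.Ico (0:ℝ) 1, ∀ t₂ ∈ Set.Ico (0:ℝ) 1,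
        hDeriv σ t₁ + lam * (h σ t₁) ^ 2 = 0 → hDeriv σ t₂ + lam * (h σ t₂) ^ 2 = 0 →
        t₁ = t₂) ∧
      (∀ a b : ℝ, a < b → Set.Icc a b ⊆ Set.Ico 0 1 →
        ¬(∀ t ∈ Set.Icc a b, lam * (h σ t) ^ 2 = -(hDeriv σ t)))) := by
  have key : ∀ lam : ℝ, ∀ t₁ ∈ Set.Ico (0:ℝ) 1, ∀ t₂ ∈ Set.Ico (0:ℝ) 1,
      hDeriv σ t₁ + lam * (h σ t₁) ^ 2 = 0 → hDeriv σ t₂ + lam * (h σ t₂) ^ 2 = 0 →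
      t₁ = t₂ := by
    intro lam t₁ h₁ t₂ h₂ e₁ e₂
    refine (aux_main σ hσ).injOn h₁ h₂ ?_
    have p₁ := aux_pos σ hσ t₁ h₁
    have p₂ := aux_pos σ hσ t₂ h₂
    have q₁ : -(hDeriv σ t₁) / (h σ t₁) ^ 2 = lam := by
      rw [div_eq_iff (by positivity)]; linarith
    have q₂ : -(hDeriv σ t₂) / (h σ t₂) ^ 2 = lam := by
      rw [div_eq_iff (by positivity)]; linarith
    exact q₁.trans q₂.symm
  refine ⟨aux_main σ hσ, fun lam _ => ⟨key lam, fun a b hab hsub H => ?_⟩⟩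
  have ha : a ∈ Set.Icc a b := ⟨le_rfl, hab.le⟩
  have hb : b ∈ Set.Icc a b := ⟨hab.le, le_rfl⟩
  exact hab.ne (key lam a (hsub ha) b (hsub hb)
    (by linarith [H a ha]) (by linarith [H b hb]))
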